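/- Let w(r) = 3^(1/4)(1 + r²)^(−1/2) for r ≥ 0. There exists a unique function J ∈ C²([0,∞)) with J(0) = 0 satisfying J''(r) + (2/r) J'(r) + 5 w(r)⁴ J(r) + (r/2) w'(r) + w(r)/4 = 0 for all r > 0. Moreover this J satisfies J'(0) = 0 and J(r)/r → 3^(1/4)/8 as r → ∞. -/

import Mathlib

noncomputable section

/-- The radial profile of the Aubin–Talenti bubble: `w(r) = 3^(1/4)(1 + r²)^(−1/2)`. -/
def wrad (r : ℝ) : ℝ := (3 : ℝ) ^ ((1 : ℝ) / 4) * (1 + r ^ 2) ^ (-(1 : ℝ) / 2)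

/-- The radial ODE `J'' + (2/r) J' + 5 w⁴ J + (r/2) w' + w/4 = 0` for `r > 0`. -/
def solvesJODE (J : ℝ → ℝ) : Prop :=
  ∀ r : ℝ, 0 < r →
    deriv (deriv J) r + (2 / r) * deriv J r + 5 * (wrad r) ^ 4 * J r
      + (r / 2) * deriv wrad r + wrad r / 4 = 0

open Set Filter Topology

/-- The weight `(1 + r²)^(−3/2)`. -/
def bubbleWeight (r : ℝ) : ℝ := (1 + r ^ 2) ^ (-(3 : ℝ) / 2)

lemma one_add_sq_pos (r : ℝ) : 0 < 1 + r ^ 2 := by positivity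

lemma hasDerivAt_one_add_sq (r : ℝ) : HasDerivAt (fun r : ℝ => 1 + r ^ 2) (2 * r) r := by
  simpa using ((hasDerivAt_id r).pow 2).const_add 1

lemma bubbleWeight_pos (r : ℝ) : 0 < bubbleWeight r :=
  Real.rpow_pos_of_pos (one_add_sq_pos r) _

lemma contDiff_bubbleWeight : ContDiff ℝ 2 bubbleWeight :=
  ContDiff.rpow_const_of_ne (by fun_prop) fun r => (one_add_sq_pos r).ne'

lemma bubbleWeight_sq (r : ℝ) : bubbleWeight r ^ 2 * (1 + r ^ 2) ^ 3 = 1 := by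
  have hx := one_add_sq_pos r
  unfold bubbleWeight
  rw [← Real.rpow_natCast, ← Real.rpow_mul hx.le, ← Real.rpow_natCast (1 + r ^ 2),
    ← Real.rpow_add hx]
  norm_num

lemma hasDerivAt_bubbleWeight (r : ℝ) :
    HasDerivAt bubbleWeight (-3 * r / (1 + r ^ 2) * bubbleWeight r) r := by
  have hx := one_add_sq_pos r
  have h := (hasDerivAt_one_add_sq r).rpow_const (p := -(3 : ℝ) / 2) (Or.inl hx.ne')
  refine h.congr_deriv ?_
  rw [Real.rpow_sub_one hx.ne', bubbleWeight]
  ring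

lemma wrad_eq (r : ℝ) :
    wrad r = (3 : ℝ) ^ ((1 : ℝ) / 4) * ((1 + r ^ 2) * bubbleWeight r) := by
  have hx := one_add_sq_pos r
  rw [wrad, bubbleWeight, ← Real.rpow_one_add' hx.le (by norm_num)]
  norm_num

lemma wrad_pow_four (r : ℝ) : wrad r ^ 4 = 3 / (1 + r ^ 2) ^ 2 := by
  have hx := one_add_sq_pos r
  have hc : ((3 : ℝ) ^ ((1 : ℝ) / 4)) ^ 4 = 3 := by
    rw [← Real.rpow_natCast, ← Real.rpow_mul (by norm_num)]
    norm_num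
  rw [wrad_eq, mul_pow, hc, eq_div_iff (by positivity)]
  linear_combination (3 * (bubbleWeight r ^ 2 * (1 + r ^ 2) ^ 3 + 1)) * bubbleWeight_sq r

lemma deriv_wrad (r : ℝ) :
    deriv wrad r = -((3 : ℝ) ^ ((1 : ℝ) / 4) * (r * bubbleWeight r)) := by
  have hx := one_add_sq_pos r
  have h := (((hasDerivAt_one_add_sq r).mul (hasDerivAt_bubbleWeight r)).const_mul
    ((3 : ℝ) ^ ((1 : ℝ) / 4))).congr_of_eventuallyEq (f₁ := wrad) (.of_forall wrad_eq)
  rw [h.deriv]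
  field_simp
  ring

lemma solvesJODE_iff (J : ℝ → ℝ) :
    solvesJODE J ↔ ∀ r : ℝ, 0 < r →
      deriv (deriv J) r + 2 / r * deriv J r + 15 / (1 + r ^ 2) ^ 2 * J r
        = (3 : ℝ) ^ ((1 : ℝ) / 4) * ((r ^ 2 - 1) / 4 * bubbleWeight r) := by
  refine forall₂_congr fun r _ => ?_
  rw [wrad_pow_four, deriv_wrad, wrad_eq]
  constructor <;> intro h <;> linear_combination h

/-! ### Uniqueness -/

lemma ContDiffOn.hasDerivAt_of_pos {F : ℝ → ℝ} (hF : ContDiffOn ℝ 2 F (Ici 0)) {r : ℝ}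
    (hr : 0 < r) :
    HasDerivAt F (deriv F r) r ∧ HasDerivAt (deriv F) (deriv (deriv F) r) r := by
  have h : ContDiffAt ℝ 2 F r := hF.contDiffAt (Ici_mem_nhds hr)
  refine ⟨(h.differentiableAt (by norm_num)).hasDerivAt, ?_⟩
  have h1 : ContDiffAt ℝ 1 (deriv F) r := h.derivWithin (by norm_num)
  exact (h1.differentiableAt (by norm_num)).hasDerivAt

/-- The Wronskian of `r D` with a solution `U` of `U'' + 15 U / (1 + r²)² = 0` vanishes. -/
lemma wronskian_eq_zero {F G U V : ℝ → ℝ} (hF : ContDiffOn ℝ 2 F (Ici 0))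
    (hG : ContDiffOn ℝ 2 G (Ici 0)) (hF0 : F 0 = 0) (hG0 : G 0 = 0)
    (hFs : solvesJODE F) (hGs : solvesJODE G)
    (hU : ∀ r, HasDerivAt U (V r) r)
    (hV : ∀ r, HasDerivAt V (-(15 / (1 + r ^ 2) ^ 2 * U r)) r) {r : ℝ} (hr : 0 < r) :
    (F r - G r + r * (deriv F r - deriv G r)) * U r - r * (F r - G r) * V r = 0 := by
  rw [solvesJODE_iff] at hFs hGs
  set W : ℝ → ℝ := fun s =>
    (F s - G s + s * (derivWithin F (Ici 0) s - derivWithin G (Ici 0) s)) * U s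
      - s * (F s - G s) * V s with hW
  have heq : ∀ {H : ℝ → ℝ} {s : ℝ}, 0 < s → derivWithin H (Ici 0) s = deriv H s :=
    fun hs => derivWithin_of_mem_nhds (Ici_mem_nhds hs)
  have hUc : Continuous U := continuous_iff_continuousAt.2 fun s => (hU s).continuousAt
  have hVc : Continuous V := continuous_iff_continuousAt.2 fun s => (hV s).continuousAt
  have hF1 := hF.continuousOn_derivWithin (uniqueDiffOn_Ici 0) (by norm_num)
  have hG1 := hG.continuousOn_derivWithin (uniqueDiffOn_Ici 0) (by norm_num)
  have hWc : ContinuousOn W (Ici 0) := by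
    have h1 := hF.continuousOn
    have h2 := hG.continuousOn
    have h3 := hUc.continuousOn (s := Ici 0)
    have h4 := hVc.continuousOn (s := Ici 0)
    fun_prop
  have hWd : ∀ s, 0 < s → HasDerivAt W 0 s := by
    intro s hs
    obtain ⟨f1, f2⟩ := hF.hasDerivAt_of_pos hs
    obtain ⟨g1, g2⟩ := hG.hasDerivAt_of_pos hs
    have h := (((f1.sub g1).add ((hasDerivAt_id s).mul (f2.sub g2))).mul (hU s)).sub
      (((hasDerivAt_id s).mul (f1.sub g1)).mul (hV s))
    refine (h.congr_of_eventuallyEq (f₁ := W) ?_).congr_deriv ?_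
    · filter_upwards [lt_mem_nhds hs] with t ht
      simp [hW, heq ht]
    · have e := hFs s hs
      have e' := hGs s hs
      have hx := one_add_sq_pos s
      simp only [Pi.sub_apply, Pi.add_apply, Pi.mul_apply, id]
      have key : s * (2 / s) = 2 := by field_simp
      linear_combination (s * U s) * (e - e') - (deriv F s - deriv G s) * U s * key
  obtain ⟨s, hs, hs'⟩ := exists_hasDerivAt_eq_slope W (fun _ => 0) hr
    (hWc.mono Icc_subset_Ici_self) (fun s hs => hWd s hs.1)
  have hW0 : W 0 = 0 := by simp [hW, hF0, hG0]
  have : W r = 0 := by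
    rw [hW0, eq_div_iff (by linarith)] at hs'
    linarith
  simpa only [hW, heq hr] using this

lemma hasDerivAt_mul_bubbleWeight {p : ℝ → ℝ} {p' r : ℝ} (hp : HasDerivAt p p' r) :
    HasDerivAt (fun r => p r * bubbleWeight r)
      ((p' - 3 * r / (1 + r ^ 2) * p r) * bubbleWeight r) r :=
  (hp.mul (hasDerivAt_bubbleWeight r)).congr_deriv (by ring)

lemma eqOn_of_solvesJODE {F G : ℝ → ℝ} (hF : ContDiffOn ℝ 2 F (Ici 0))
    (hG : ContDiffOn ℝ 2 G (Ici 0)) (hF0 : F 0 = 0) (hG0 : G 0 = 0)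
    (hFs : solvesJODE F) (hGs : solvesJODE G) : EqOn F G (Ici 0) := by
  intro r hr
  rcases eq_or_lt_of_le (mem_Ici.1 hr) with rfl | hr
  · rw [hF0, hG0]
  have w1 := wronskian_eq_zero hF hG hF0 hG0 hFs hGs
    (U := fun r => (r - r ^ 3) * bubbleWeight r)
    (V := fun r => ((1 - 5 * r ^ 2) / (1 + r ^ 2)) * bubbleWeight r)
    (fun r => by
      have hx := one_add_sq_pos r
      refine (hasDerivAt_mul_bubbleWeight
        ((hasDerivAt_id r).sub (hasDerivAt_pow 3 r))).congr_deriv ?_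
      simp only [Pi.sub_apply, id]
      field_simp
      ring)
    (fun r => by
      have hx := one_add_sq_pos r
      refine (hasDerivAt_mul_bubbleWeight
        ((((hasDerivAt_pow 2 r).const_mul 5).const_sub 1).div
          (hasDerivAt_one_add_sq r) hx.ne')).congr_deriv ?_
      simp only [Pi.div_apply]
      field_simp
      ring) hr
  have w2 := wronskian_eq_zero hF hG hF0 hG0 hFs hGs
    (U := fun r => (r ^ 4 - 6 * r ^ 2 + 1) * bubbleWeight r)
    (V := fun r => ((r ^ 5 + 10 * r ^ 3 - 15 * r) / (1 + r ^ 2)) * bubbleWeight r)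
    (fun r => by
      have hx := one_add_sq_pos r
      refine (hasDerivAt_mul_bubbleWeight
        (((hasDerivAt_pow 4 r).sub ((hasDerivAt_pow 2 r).const_mul 6)).add_const 1)).congr_deriv ?_
      simp only [Pi.sub_apply]
      field_simp
      ring)
    (fun r => by
      have hx := one_add_sq_pos r
      refine (hasDerivAt_mul_bubbleWeight
        ((((hasDerivAt_pow 5 r).add ((hasDerivAt_pow 3 r).const_mul 10)).sub
          ((hasDerivAt_id r).const_mul 15)).div
          (hasDerivAt_one_add_sq r) hx.ne')).congr_deriv ?_
      simp only [Pi.div_apply, Pi.sub_apply, Pi.add_apply, id]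
      field_simp
      ring) hr
  have hx := one_add_sq_pos r
  have hh := bubbleWeight_sq r
  have hdet : (1 - 5 * r ^ 2) / (1 + r ^ 2) * (r ^ 4 - 6 * r ^ 2 + 1)
      - (r ^ 5 + 10 * r ^ 3 - 15 * r) / (1 + r ^ 2) * (r - r ^ 3) = (1 + r ^ 2) ^ 3 := by
    field_simp
    ring
  have key : r * (F r - G r) = 0 := by
    linear_combination
      -(r ^ 4 - 6 * r ^ 2 + 1) * bubbleWeight r * w1 + (r - r ^ 3) * bubbleWeight r * w2
      - r * (F r - G r) * hh - r * (F r - G r) * bubbleWeight r ^ 2 * hdet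
  linarith [(mul_eq_zero.1 key).resolve_left hr.ne']

/-! ### The explicit solution -/

/-- `arctan r / r`, extended continuously to `r = 0`. -/
def arctanSlope : ℝ → ℝ := dslope Real.arctan 0

lemma arctanSlope_of_ne {r : ℝ} (hr : r ≠ 0) : arctanSlope r = Real.arctan r / r := by
  simp [arctanSlope, dslope_of_ne _ hr, slope_def_field]

lemma arctanSlope_zero : arctanSlope 0 = 1 := by
  simp [arctanSlope, (Real.hasDerivAt_arctan 0).deriv]

lemma arctanSlope_neg (r : ℝ) : arctanSlope (-r) = arctanSlope r := by
  rcases eq_or_ne r 0 with rfl | hr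
  · simp
  · rw [arctanSlope_of_ne hr, arctanSlope_of_ne (neg_ne_zero.2 hr), Real.arctan_neg, neg_div_neg_eq]

lemma hasDerivAt_arctanSlope {r : ℝ} (hr : r ≠ 0) :
    HasDerivAt arctanSlope ((1 / (1 + r ^ 2) - arctanSlope r) / r) r := by
  have hx := one_add_sq_pos r
  refine (((Real.hasDerivAt_arctan r).div (hasDerivAt_id r) hr).congr_of_eventuallyEq
    (f₁ := arctanSlope) ?_).congr_deriv ?_
  · filter_upwards [isOpen_ne.mem_nhds hr] with t ht using arctanSlope_of_ne ht
  · rw [arctanSlope_of_ne hr]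
    simp only [id]
    field_simp

lemma contDiff_arctanSlope : ContDiff ℝ 2 arctanSlope := by
  refine contDiff_iff_contDiffAt.2 fun r => ?_
  rcases eq_or_ne r 0 with rfl | hr
  · obtain ⟨p, hp⟩ : AnalyticAt ℝ Real.arctan 0 :=
      Real.contDiff_arctan.analyticOnNhd (s := univ) 0 (mem_univ _)
    exact AnalyticAt.contDiffAt ⟨_, hp.has_fpower_series_dslope_fslope⟩
  · refine (Real.contDiff_arctan.contDiffAt.div contDiffAt_id hr).congr_of_eventuallyEq ?_
    filter_upwards [isOpen_ne.mem_nhds hr] with t ht using arctanSlope_of_ne ht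

/-- The coefficient of `1 - r²` in the explicit solution. -/
def coeffP (r : ℝ) : ℝ :=
  1 + r ^ 2 - 10 * Real.log (1 + r ^ 2) - 24 / (1 + r ^ 2) + 8 / (1 + r ^ 2) ^ 2 + 15

def coeffP' (r : ℝ) : ℝ :=
  2 * r - 20 * r / (1 + r ^ 2) + 48 * r / (1 + r ^ 2) ^ 2 - 32 * r / (1 + r ^ 2) ^ 3

def coeffP'' (r : ℝ) : ℝ :=
  2 - 20 / (1 + r ^ 2) + 40 * r ^ 2 / (1 + r ^ 2) ^ 2 + 48 / (1 + r ^ 2) ^ 2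
    - 192 * r ^ 2 / (1 + r ^ 2) ^ 3 - 32 / (1 + r ^ 2) ^ 3 + 192 * r ^ 2 / (1 + r ^ 2) ^ 4

/-- The coefficient of `r⁴ - 6r² + 1` in the explicit solution. -/
def coeffN (r : ℝ) : ℝ :=
  1 - 5 / 2 * arctanSlope r + 5 / 2 / (1 + r ^ 2) - 1 / (1 + r ^ 2) ^ 2

def coeffN' (r : ℝ) : ℝ :=
  -(5 / 2 * ((1 / (1 + r ^ 2) - arctanSlope r) / r)) - 5 * r / (1 + r ^ 2) ^ 2
    + 4 * r / (1 + r ^ 2) ^ 3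

def coeffN'' (r : ℝ) : ℝ :=
  -(5 / 2 * ((-2 * r / (1 + r ^ 2) ^ 2 - (1 / (1 + r ^ 2) - arctanSlope r) / r) / r
      - (1 / (1 + r ^ 2) - arctanSlope r) / r ^ 2))
    - 5 / (1 + r ^ 2) ^ 2 + 20 * r ^ 2 / (1 + r ^ 2) ^ 3 + 4 / (1 + r ^ 2) ^ 3
    - 24 * r ^ 2 / (1 + r ^ 2) ^ 4

lemma hasDerivAt_div_one_add_sq_pow {p : ℝ → ℝ} {p' r : ℝ} (n : ℕ) (hp : HasDerivAt p p' r) :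
    HasDerivAt (fun r => p r / (1 + r ^ 2) ^ n)
      (p' / (1 + r ^ 2) ^ n - 2 * n * r * p r / (1 + r ^ 2) ^ (n + 1)) r := by
  have hx := one_add_sq_pos r
  refine (hp.div ((hasDerivAt_one_add_sq r).pow n) (pow_ne_zero n hx.ne')).congr_deriv ?_
  rcases n with _ | n
  · simp
  · simp only [Pi.pow_apply, Nat.add_sub_cancel]
    field_simp
    ring

lemma hasDerivAt_coeffP (r : ℝ) : HasDerivAt coeffP (coeffP' r) r := by
  have hx := one_add_sq_pos r
  have h := (((((hasDerivAt_one_add_sq r).sub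
    (((hasDerivAt_one_add_sq r).log hx.ne').const_mul 10)).sub
    (hasDerivAt_div_one_add_sq_pow 1 (hasDerivAt_const r 24))).add
    (hasDerivAt_div_one_add_sq_pow 2 (hasDerivAt_const r 8))).add_const 15)
  refine (h.congr_of_eventuallyEq (.of_forall fun t => ?_)).congr_deriv ?_
  · simp [coeffP]
  · simp only [coeffP']
    field_simp
    ring

lemma hasDerivAt_coeffP' (r : ℝ) : HasDerivAt coeffP' (coeffP'' r) r := by
  have hx := one_add_sq_pos r
  have hm (a : ℝ) : HasDerivAt (fun r => a * r) a r := by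
    simpa using (hasDerivAt_id r).const_mul a
  have h := (((hm 2).sub (hasDerivAt_div_one_add_sq_pow 1 (hm 20))).add
    (hasDerivAt_div_one_add_sq_pow 2 (hm 48))).sub (hasDerivAt_div_one_add_sq_pow 3 (hm 32))
  refine (h.congr_of_eventuallyEq (.of_forall fun t => ?_)).congr_deriv ?_
  · simp [coeffP']
  · simp only [coeffP'']
    field_simp
    ring

lemma hasDerivAt_coeffN {r : ℝ} (hr : r ≠ 0) : HasDerivAt coeffN (coeffN' r) r := by
  have hx := one_add_sq_pos r
  have h := ((((hasDerivAt_arctanSlope hr).const_mul (5 / 2)).const_sub 1).add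
    (hasDerivAt_div_one_add_sq_pow 1 (hasDerivAt_const r (5 / 2)))).sub
    (hasDerivAt_div_one_add_sq_pow 2 (hasDerivAt_const r 1))
  refine (h.congr_of_eventuallyEq (.of_forall fun t => ?_)).congr_deriv ?_
  · simp [coeffN]
  · simp only [coeffN']
    field_simp
    ring

lemma hasDerivAt_coeffN' {r : ℝ} (hr : r ≠ 0) : HasDerivAt coeffN' (coeffN'' r) r := by
  have hx := one_add_sq_pos r
  have hm (a : ℝ) : HasDerivAt (fun r => a * r) a r := by
    simpa using (hasDerivAt_id r).const_mul a
  have h := (((((hasDerivAt_div_one_add_sq_pow 1 (hasDerivAt_const r 1)).sub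
    (hasDerivAt_arctanSlope hr)).div (hasDerivAt_id r) hr).const_mul (5 / 2)).neg.sub
    (hasDerivAt_div_one_add_sq_pow 2 (hm 5))).add (hasDerivAt_div_one_add_sq_pow 3 (hm 4))
  refine (h.congr_of_eventuallyEq (.of_forall fun t => ?_)).congr_deriv ?_
  · simp [coeffN']
  · simp only [coeffN'', Pi.sub_apply, id]
    field_simp
    ring

/-- The explicit solution divided by `3^(1/4) (1 + r²)^(−3/2)`. -/
def profileM (r : ℝ) : ℝ :=
  (1 - r ^ 2) / 8 * coeffP r + (r ^ 4 - 6 * r ^ 2 + 1) / 4 * coeffN r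

def profileM' (r : ℝ) : ℝ :=
  -r / 4 * coeffP r + (1 - r ^ 2) / 8 * coeffP' r + (r ^ 3 - 3 * r) * coeffN r
    + (r ^ 4 - 6 * r ^ 2 + 1) / 4 * coeffN' r

def profileM'' (r : ℝ) : ℝ :=
  -1 / 4 * coeffP r - r / 2 * coeffP' r + (1 - r ^ 2) / 8 * coeffP'' r
    + (3 * r ^ 2 - 3) * coeffN r + 2 * (r ^ 3 - 3 * r) * coeffN' r
    + (r ^ 4 - 6 * r ^ 2 + 1) / 4 * coeffN'' r

lemma hasDerivAt_profileM {r : ℝ} (hr : r ≠ 0) : HasDerivAt profileM (profileM' r) r := by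
  have h := ((((hasDerivAt_pow 2 r).const_sub 1).div_const 8).mul (hasDerivAt_coeffP r)).add
    (((((hasDerivAt_pow 4 r).sub ((hasDerivAt_pow 2 r).const_mul 6)).add_const 1).div_const 4).mul
      (hasDerivAt_coeffN hr))
  refine h.congr_deriv ?_
  simp only [profileM', Pi.sub_apply]
  push_cast
  ring

lemma hasDerivAt_profileM' {r : ℝ} (hr : r ≠ 0) : HasDerivAt profileM' (profileM'' r) r := by
  have h := (((((hasDerivAt_id r).neg.div_const 4).mul (hasDerivAt_coeffP r)).add
    ((((hasDerivAt_pow 2 r).const_sub 1).div_const 8).mul (hasDerivAt_coeffP' r))).add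
    (((hasDerivAt_pow 3 r).sub ((hasDerivAt_id r).const_mul 3)).mul (hasDerivAt_coeffN hr))).add
    (((((hasDerivAt_pow 4 r).sub ((hasDerivAt_pow 2 r).const_mul 6)).add_const 1).div_const 4).mul
      (hasDerivAt_coeffN' hr))
  refine h.congr_deriv ?_
  simp only [profileM'', Pi.sub_apply, Pi.neg_apply, id]
  push_cast
  ring

lemma profileM_ode {r : ℝ} (hr : r ≠ 0) :
    profileM'' r + (2 / r - 6 * r / (1 + r ^ 2)) * profileM' r
      + 6 / (1 + r ^ 2) * profileM r
      = (r ^ 2 - 1) / 4 := by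
  have hx := one_add_sq_pos r
  simp only [profileM, profileM', profileM'', coeffP, coeffP', coeffP'', coeffN, coeffN', coeffN'']
  generalize Real.log (1 + r ^ 2) = L
  generalize arctanSlope r = T
  field_simp
  ring

lemma contDiff_profileM : ContDiff ℝ 2 profileM := by
  have h := contDiff_arctanSlope
  have hx (r : ℝ) : 1 + r ^ 2 ≠ 0 := (one_add_sq_pos r).ne'
  have hx2 (r : ℝ) : (1 + r ^ 2) ^ 2 ≠ 0 := pow_ne_zero 2 (hx r)
  unfold profileM coeffP coeffN
  fun_prop (disch := assumption)

/-- The explicit solution. -/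
def solutionJ (r : ℝ) : ℝ := (3 : ℝ) ^ ((1 : ℝ) / 4) * (profileM r * bubbleWeight r)

lemma contDiff_solutionJ : ContDiff ℝ 2 solutionJ :=
  contDiff_const.mul (contDiff_profileM.mul contDiff_bubbleWeight)

lemma solutionJ_zero : solutionJ 0 = 0 := by
  simp [solutionJ, profileM, coeffP, coeffN, arctanSlope_zero]
  norm_num

lemma solutionJ_neg (r : ℝ) : solutionJ (-r) = solutionJ r := by
  simp [solutionJ, profileM, coeffP, coeffN, arctanSlope_neg, bubbleWeight, Even.neg_pow (show Even 4 by decide)]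

lemma deriv_solutionJ_zero : deriv solutionJ 0 = 0 := by
  have h := deriv_comp_neg (f := solutionJ) (x := 0)
  simp only [solutionJ_neg, neg_zero] at h
  linarith

lemma solvesJODE_solutionJ : solvesJODE solutionJ := by
  rw [solvesJODE_iff]
  intro r hr
  have hd : ∀ t, 0 < t → HasDerivAt solutionJ ((3 : ℝ) ^ ((1 : ℝ) / 4) *
      ((profileM' t - 3 * t / (1 + t ^ 2) * profileM t) * bubbleWeight t)) t := fun t ht =>
    (hasDerivAt_mul_bubbleWeight (hasDerivAt_profileM ht.ne')).const_mul _
  have hx := one_add_sq_pos r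
  have hq : HasDerivAt (fun t : ℝ => 3 * t / (1 + t ^ 2)) _ r :=
    ((hasDerivAt_id r).const_mul 3).div (hasDerivAt_one_add_sq r) hx.ne'
  have hdd := ((hasDerivAt_mul_bubbleWeight ((hasDerivAt_profileM' hr.ne').sub
    (hq.mul (hasDerivAt_profileM hr.ne')))).const_mul
      ((3 : ℝ) ^ ((1 : ℝ) / 4))).congr_of_eventuallyEq (f₁ := deriv solutionJ) (by
    filter_upwards [lt_mem_nhds hr] with t ht
    rw [(hd t ht).deriv]
    rfl)
  rw [hdd.deriv, (hd r hr).deriv, solutionJ, ← profileM_ode hr.ne']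
  simp only [Pi.sub_apply, Pi.mul_apply, id]
  field_simp
  ring

lemma tendsto_solutionJ_div :
    Tendsto (fun r => solutionJ r / r) atTop (𝓝 ((3 : ℝ) ^ ((1 : ℝ) / 4) / 8)) := by
  have hi : Tendsto (fun r : ℝ => r⁻¹) atTop (𝓝 0) := tendsto_inv_atTop_zero
  have hy : Tendsto (fun r : ℝ => 1 + r ^ 2) atTop atTop :=
    tendsto_atTop_add_const_left _ _ (tendsto_pow_atTop (by norm_num))
  have hyi : Tendsto (fun r : ℝ => (1 + r ^ 2)⁻¹) atTop (𝓝 0) := hy.inv_tendsto_atTop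
  have hlog : Tendsto (fun r : ℝ => Real.log (1 + r ^ 2) / (1 + r ^ 2)) atTop (𝓝 0) :=
    Real.isLittleO_log_id_atTop.tendsto_div_nhds_zero.comp hy
  have hT : Tendsto arctanSlope atTop (𝓝 0) := by
    have h := (tendsto_nhds_of_tendsto_nhdsWithin Real.tendsto_arctan_atTop).mul hi
    rw [mul_zero] at h
    refine h.congr' ?_
    filter_upwards [eventually_gt_atTop 0] with t ht
    rw [arctanSlope_of_ne ht.ne', div_eq_mul_inv]
  have hN : Tendsto coeffN atTop (𝓝 1) := by
    have h := ((hT.const_mul (5 / 2)).const_sub 1).add (hyi.const_mul (5 / 2)) |>.sub (hyi.pow 2)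
    norm_num at h
    refine h.congr fun t => ?_
    simp only [coeffN]
    field_simp
  have hP : Tendsto (fun r => coeffP r * (1 + r ^ 2)⁻¹) atTop (𝓝 1) := by
    have h := ((((hlog.const_mul 10).const_sub 1).sub ((hyi.pow 2).const_mul 24)).add
      ((hyi.pow 3).const_mul 8)).add (hyi.const_mul 15)
    norm_num at h
    refine h.congr fun t => ?_
    have hx := one_add_sq_pos t
    simp only [coeffP]
    field_simp
  have hM : Tendsto (fun r => profileM r * (1 + r ^ 2)⁻¹ ^ 2) atTop (𝓝 (1 / 8)) := by
    have h := (((hyi.const_mul 2).sub_const 1).mul hP |>.div_const 8).add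
      ((((hyi.const_mul 8).const_sub 1).add ((hyi.pow 2).const_mul 8)).mul hN |>.div_const 4)
    norm_num at h
    norm_num
    refine h.congr fun t => ?_
    have hx := one_add_sq_pos t
    simp only [profileM]
    field_simp
    ring
  have hW : Tendsto (fun r : ℝ => (1 + r ^ 2) ^ ((1 : ℝ) / 2) * r⁻¹) atTop (𝓝 1) := by
    have h : Tendsto (fun r : ℝ => (r⁻¹ ^ 2 + 1) ^ ((1 : ℝ) / 2)) atTop (𝓝 1) := by
      have := ((hi.pow 2).add_const 1).rpow_const (p := (1 : ℝ) / 2) (by norm_num)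
      simpa using this
    refine h.congr' ?_
    filter_upwards [eventually_gt_atTop 0] with t ht
    rw [← Real.sqrt_eq_rpow, ← Real.sqrt_eq_rpow,
      show t⁻¹ ^ 2 + 1 = (1 + t ^ 2) / t ^ 2 by field_simp, Real.sqrt_div (by positivity),
      Real.sqrt_sq ht.le, div_eq_mul_inv]
  have h := (hM.mul hW).const_mul ((3 : ℝ) ^ ((1 : ℝ) / 4))
  rw [mul_one, ← div_eq_mul_one_div] at h
  refine h.congr fun t => ?_
  have hx := one_add_sq_pos t
  have hb : bubbleWeight t = (1 + t ^ 2) ^ ((1 : ℝ) / 2) * (1 + t ^ 2)⁻¹ ^ 2 := by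
    rw [bubbleWeight, inv_pow, ← Real.rpow_natCast (1 + t ^ 2) 2, ← Real.rpow_neg hx.le, ← Real.rpow_add hx]
    norm_num
  rw [solutionJ, hb]
  ring

/-- There is a unique `J ∈ C²([0,∞))` with `J(0) = 0` solving
`J'' + (2/r)J' + 5w⁴J + (r/2)w' + w/4 = 0` on `(0,∞)`; moreover it satisfies `J'(0) = 0`
and `J(r)/r → 3^(1/4)/8` as `r → ∞`. -/
theorem J_exists_unique :
    ∃ J : ℝ → ℝ,
      (ContDiffOn ℝ 2 J (Set.Ici 0) ∧ J 0 = 0 ∧ solvesJODE J) ∧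
      (∀ J' : ℝ → ℝ, ContDiffOn ℝ 2 J' (Set.Ici 0) → J' 0 = 0 → solvesJODE J' →
        Set.EqOn J' J (Set.Ici 0)) ∧
      derivWithin J (Set.Ici 0) 0 = 0 ∧
      Filter.Tendsto (fun r => J r / r) Filter.atTop
        (nhds ((3 : ℝ) ^ ((1 : ℝ) / 4) / 8)) := by
  have hC := contDiff_solutionJ.contDiffOn (s := Ici 0)
  refine ⟨solutionJ, ⟨hC, solutionJ_zero, solvesJODE_solutionJ⟩, ?_, ?_, tendsto_solutionJ_div⟩
  · intro F hF hF0 hFs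
    exact eqOn_of_solvesJODE hF hC hF0 solutionJ_zero hFs solvesJODE_solutionJ
  · have hd : DifferentiableAt ℝ solutionJ 0 :=
      contDiff_solutionJ.contDiffAt.differentiableAt (by norm_num)
    rw [hd.derivWithin (uniqueDiffOn_Ici 0 0 self_mem_Ici), deriv_solutionJ_zero]
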